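/- arXiv:2401.05588 — 2 statements merged into one kernel-verified Lean document; each statement's English description precedes it below -/
import Mathlib

section
/- Let F be a field of characteristic zero and let L be a finite-dimensional semi-simple left Leibniz algebra over F that is not a Lie algebra (i.e., xx ≠ 0 for some x ∈ L). Then L has a derivation that is not inner: there exists an F-linear map D : L → L with D(xy) = D(x)y + xD(y) for all x, y ∈ L such that D is not equal to the left multiplication operator L_x : y ↦ xy for any x ∈ L. -/
universe u v w

section LeibnizDefs

variable (F : Type v) [Field F] {L : Type u} [AddCommGroup L] [Module F L]

/-- The Leibniz kernel `Leib(L) = span_F {x² : x ∈ L}` of a (Leibniz) multiplication. -/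
def leibKer (mul : L → L → L) : Submodule F L :=
  Submodule.span F {z : L | ∃ x : L, z = mul x x}

/-- The derived subalgebra `L² = span_F {xy : x, y ∈ L}`. -/
def derivedSub (mul : L → L → L) : Submodule F L :=
  Submodule.span F {z : L | ∃ x y : L, z = mul x y}

/-- A (two-sided) ideal of an algebra with multiplication `mul`. -/
def IsIdealOf (mul : L → L → L) (I : Submodule F L) : Prop :=
  ∀ x : L, ∀ a ∈ I, mul x a ∈ I ∧ mul a x ∈ I

/-- The derived series of a subspace: `I⁽⁰⁾ = I`, `I⁽ⁿ⁺¹⁾ = span {ab : a, b ∈ I⁽ⁿ⁾}`. -/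
def derSeries (mul : L → L → L) (I : Submodule F L) : ℕ → Submodule F L
  | 0 => I
  | n + 1 => Submodule.span F
      {z : L | ∃ a ∈ derSeries mul I n, ∃ b ∈ derSeries mul I n, z = mul a b}

/-- A subspace is solvable if its derived series vanishes eventually. -/
def IsSolvableSub (mul : L → L → L) (I : Submodule F L) : Prop :=
  ∃ n : ℕ, derSeries F mul I n = ⊥

/-- A left Leibniz algebra is semi-simple if every solvable ideal is contained
in its Leibniz kernel. -/
def IsSemisimpleLeibniz (mul : L → L → L) : Prop :=
  ∀ I : Submodule F L, IsIdealOf F mul I → IsSolvableSub F mul I → I ≤ leibKer F mul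

/-- A left Leibniz algebra is Lie-simple if the only ideals containing `Leib(L)`
are `Leib(L)` and `L`, and `Leib(L) ⊊ L²`. -/
def IsLieSimpleLeibniz (mul : L → L → L) : Prop :=
  (∀ I : Submodule F L, IsIdealOf F mul I → leibKer F mul ≤ I →
      I = leibKer F mul ∨ I = ⊤) ∧ leibKer F mul < derivedSub F mul

/-- A left Leibniz algebra is simple if its only ideals are `0`, `Leib(L)` and `L`,
and `Leib(L) ⊊ L²`. -/
def IsSimpleLeibniz (mul : L → L → L) : Prop :=
  (∀ I : Submodule F L, IsIdealOf F mul I →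
      I = ⊥ ∨ I = leibKer F mul ∨ I = ⊤) ∧ leibKer F mul < derivedSub F mul

/-- A non-abelian algebra whose only ideals are `0` and the whole algebra. -/
def IsSimpleMul (mul : L → L → L) : Prop :=
  (∃ x y : L, mul x y ≠ 0) ∧
  ∀ I : Submodule F L, IsIdealOf F mul I → I = ⊥ ∨ I = ⊤

/-- The multiplication is bilinear over `F`. -/
def IsBilinearMul (mul : L → L → L) : Prop :=
  (∀ x y z : L, mul (x + y) z = mul x z + mul y z) ∧
  (∀ x y z : L, mul x (y + z) = mul x y + mul x z) ∧
  (∀ (c : F) (x y : L), mul (c • x) y = c • mul x y) ∧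
  (∀ (c : F) (x y : L), mul x (c • y) = c • mul x y)

/-- The left Leibniz identity `x(yz) = (xy)z + y(xz)`. -/
def IsLeftLeibnizMul (mul : L → L → L) : Prop :=
  ∀ x y z : L, mul x (mul y z) = mul (mul x y) z + mul y (mul x z)

end LeibnizDefs

section LieDefs

variable (F : Type v) [Field F] (g : Type u) [LieRing g] [LieAlgebra F g]

/-- A Lie algebra is semi-simple if its only solvable ideal is `0`. -/
def IsSemisimpleLieDef : Prop :=
  ∀ I : Submodule F g, IsIdealOf F (fun x y : g => ⁅x, y⁆) I →
    IsSolvableSub F (fun x y : g => ⁅x, y⁆) I → I = ⊥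

/-- A Lie algebra is simple if it is non-abelian and its only ideals are `0` and `g`. -/
def IsSimpleLieDef : Prop :=
  IsSimpleMul F (fun x y : g => ⁅x, y⁆)

end LieDefs

section ModuleDefs

variable (F : Type v) [Field F] (g : Type u) [LieRing g] [LieAlgebra F g]
  (M : Type w) [AddCommGroup M] [Module F M] [LieRingModule g M] [LieModule F g M]

/-- `gM := span_F {x·m : x ∈ g, m ∈ M}`. -/
def gModSpan : Submodule F M :=
  Submodule.span F {m : M | ∃ (x : g) (n : M), m = ⁅x, n⁆}

/-- A subspace of `M` that is stable under the `g`-action. -/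
def IsLieSubmoduleOf (N : Submodule F M) : Prop :=
  ∀ x : g, ∀ n ∈ N, ⁅x, n⁆ ∈ N

/-- `M` is an irreducible `g`-module: `M ≠ 0` and its only `g`-submodules are `0` and `M`. -/
def IsIrreducibleLieModule : Prop :=
  (∃ m : M, m ≠ 0) ∧
  ∀ N : Submodule F M, IsLieSubmoduleOf F g M N → N = ⊥ ∨ N = ⊤

/-- `M` is completely reducible: every `g`-submodule has a `g`-invariant complement. -/
def IsCompletelyReducibleLieModule : Prop :=
  ∀ N : Submodule F M, IsLieSubmoduleOf F g M N →
    ∃ N' : Submodule F M, IsLieSubmoduleOf F g M N' ∧ N ⊓ N' = ⊥ ∧ N ⊔ N' = ⊤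

/-- `M` contains no non-zero trivial `g`-submodule. -/
def HasNoTrivialLieSubmodule : Prop :=
  ∀ N : Submodule F M, IsLieSubmoduleOf F g M N →
    (∀ x : g, ∀ n ∈ N, ⁅x, n⁆ = (0 : M)) → N = ⊥

end ModuleDefs

/-- The multiplication `(x, m)(y, n) := ([x, y], x·n)` of the left hemi-semidirect
product `g ⋉_ℓ M`. -/
def hemiMul {g : Type u} {M : Type w} [LieRing g] [AddCommGroup M]
    [LieRingModule g M] (a b : g × M) : g × M :=
  (⁅a.1, b.1⁆, ⁅a.1, b.2⁆)

set_option linter.unusedSectionVars false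
open LieModule LieAlgebra
attribute [local instance 100] LieRing.ofAssociativeRing
section
variable (F : Type*) [Field F] [CharZero F] {g : Type*} [LieRing g] [LieAlgebra F g] [FiniteDimensional F g]
  (E : Type*) [AddCommGroup E] [Module F E] [LieRingModule g E] [LieModule F g E] [FiniteDimensional F E]

theorem casimir_exists (hB : (traceForm F g E).Nondegenerate) :
    ∃ c : E →ₗ[F] E, (∀ (x : g) (e : E), c ⁅x, e⁆ = ⁅x, c e⁆) ∧
      LinearMap.trace F E c = (Module.finrank F g : F) ∧
      (∀ φ : E →ₗ[F] F, (∀ (x : g) (e : E), φ ⁅x, e⁆ = 0) → ∀ e, φ (c e) = 0) := by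
  classical
  let B := traceForm F g E
  let b := Module.finBasis F g
  let b' := B.dualBasis hB b
  have hs : B.IsSymm := ⟨traceForm_comm F g E⟩
  have h1 : ∀ y : g, y = ∑ j, B y (b' j) • b j := by
    intro y
    conv_lhs => rw [← b.sum_repr y]
    refine Finset.sum_congr rfl fun j _ => ?_
    congr 1
    have := B.dualBasis_repr_apply hB b' y j
    rwa [B.dualBasis_dualBasis hB hs b] at this
  have h2 : ∀ y : g, y = ∑ j, B y (b j) • b' j := by
    intro y
    conv_lhs => rw [← b'.sum_repr y]
    refine Finset.sum_congr rfl fun j _ => ?_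
    congr 1
    exact B.dualBasis_repr_apply hB b y j
  refine ⟨∑ i, toEnd F g E (b i) ∘ₗ toEnd F g E (b' i), ?_, ?_, ?_⟩
  · intro x e
    simp only [LinearMap.sum_apply, LinearMap.comp_apply, toEnd_apply_apply, lie_sum]
    symm
    rw [← sub_eq_zero, ← Finset.sum_sub_distrib]
    have h3 : ∀ i, ⁅x, ⁅b i, ⁅b' i, e⁆⁆⁆ - ⁅b i, ⁅b' i, ⁅x, e⁆⁆⁆
        = ⁅⁅x, b i⁆, ⁅b' i, e⁆⁆ + ⁅b i, ⁅⁅x, b' i⁆, e⁆⁆ := by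
      intro i
      rw [leibniz_lie x (b i), leibniz_lie x (b' i), lie_add]
      abel
    simp only [h3, Finset.sum_add_distrib]
    have h4 : ∀ i, ⁅⁅x, b i⁆, ⁅b' i, e⁆⁆ = ∑ j, B ⁅x, b i⁆ (b' j) • ⁅b j, ⁅b' i, e⁆⁆ := by
      intro i
      conv_lhs => rw [h1 ⁅x, b i⁆]
      simp [sum_lie]
    have h5 : ∀ i, ⁅b i, ⁅⁅x, b' i⁆, e⁆⁆ = ∑ j, B ⁅x, b' i⁆ (b j) • ⁅b i, ⁅b' j, e⁆⁆ := by
      intro i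
      conv_lhs => rw [h2 ⁅x, b' i⁆]
      simp [sum_lie, lie_sum]
    simp only [h4, h5]
    rw [Finset.sum_comm, ← Finset.sum_add_distrib]
    refine Finset.sum_eq_zero fun i _ => ?_
    rw [← Finset.sum_add_distrib]
    refine Finset.sum_eq_zero fun j _ => ?_
    rw [← add_smul]
    have : B ⁅x, b j⁆ (b' i) + B ⁅x, b' i⁆ (b j) = 0 := by
      rw [show B ⁅x, b j⁆ (b' i) = _ from traceForm_apply_lie_apply' F g E x (b j) (b' i),
        show B ⁅x, b' i⁆ (b j) = _ from traceForm_comm F g E _ _]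
      exact neg_add_cancel _
    rw [this, zero_smul]
  · rw [map_sum]
    have : ∀ i, LinearMap.trace F E (toEnd F g E (b i) ∘ₗ toEnd F g E (b' i)) = 1 := by
      intro i
      have := B.apply_dualBasis_right hB hs b i i
      rw [if_pos rfl] at this
      exact this
    simp [this]
  · intro φ h e
    simp [LinearMap.sum_apply, h]

theorem isNilp_of_faithful (P : LieIdeal F g) (hf : ∀ x ∈ P, (∀ e : E, ⁅x, e⁆ = 0) → x = 0)
    (hn : ∀ x ∈ P, IsNilpotent (toEnd F g E x)) : LieRing.IsNilpotent P := by
  rw [LieAlgebra.isNilpotent_iff_forall (R := F)]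
  rintro ⟨x, hx⟩
  obtain ⟨n, hn⟩ := LieAlgebra.ad_nilpotent_of_nilpotent (R := F) (hn x hx)
  refine ⟨n, ?_⟩
  have key : ∀ (m : ℕ) (y : P), toEnd F g E (((ad F P ⟨x, hx⟩) ^ m) y : P)
      = ((ad F (Module.End F E) (toEnd F g E x)) ^ m) (toEnd F g E (y : g)) := by
    intro m
    induction m with
    | zero => intro y; simp
    | succ k ih => intro y; rw [pow_succ, pow_succ, Module.End.mul_apply, Module.End.mul_apply, ih]; simp
  ext y
  have h := key n y
  rw [hn] at h
  have := hf _ (((ad F P ⟨x, hx⟩) ^ n) y : P).2 (fun e => by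
    have := LinearMap.congr_fun h e
    simpa using this)
  simpa using this

theorem traceForm_nondeg [HasTrivialRadical F g] (C : LieIdeal F g)
    (hC : ∀ x ∈ C, (∀ e : E, ⁅x, e⁆ = 0) → x = 0)
    (hN : ∀ x : g, ∃ y ∈ C, ∀ e : E, ⁅x, e⁆ = ⁅y, e⁆) :
    (traceForm F C E).Nondegenerate := by
  refine (traceForm_isSymm F C E).isRefl.nondegenerate_iff_separatingLeft.mpr ?_
  let R : LieIdeal F g := C ⊓ LieAlgebra.InvariantForm.orthogonal (traceForm F g E)
    (traceForm_lieInvariant F g E) ⊤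
  have hRC : R ≤ C := inf_le_left
  have hR0 : traceForm F R E = 0 := by
    ext ⟨x, hx⟩ ⟨y, hy⟩
    have := (LieAlgebra.InvariantForm.mem_orthogonal _ _ _ _).1 hy.2 x trivial
    exact this
  have hnil := isNilpotent_derivedSeries_of_traceForm_eq_zero hR0
  rw [LieModule.isNilpotent_iff_forall' (R := F)] at hnil
  have hP : LieRing.IsNilpotent (⁅R, R⁆ : LieIdeal F g) := by
    refine isNilp_of_faithful F E _ (fun x hx => hC x (hRC (LieSubmodule.lie_le_left R R hx))) ?_
    intro x hx
    refine hnil ⟨⟨x, LieSubmodule.lie_le_left R R hx⟩, ?_⟩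
    rw [LieIdeal.derivedSeries_eq_derivedSeriesOfIdeal_comap, LieIdeal.mem_comap]
    exact hx
  have hP0 : (⁅R, R⁆ : LieIdeal F g) = ⊥ := HasTrivialRadical.eq_bot_of_isSolvable _
  have hab : IsLieAbelian R := by
    rwa [LieSubmodule.lie_abelian_iff_lie_self_eq_bot]
  have hRb : R = ⊥ := HasTrivialRadical.eq_bot_of_isSolvable _
  intro x hx
  have : (x : g) ∈ R := by
    refine ⟨x.2, (LieAlgebra.InvariantForm.mem_orthogonal _ _ _ _).2 ?_⟩
    intro z _
    obtain ⟨y, hy, hzy⟩ := hN z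
    have h := hx ⟨y, hy⟩
    rw [traceForm_comm]
    have hz : toEnd F g E z = toEnd F g E y := by ext e; simp [hzy]
    rw [traceForm_apply_apply, hz]
    exact h
  rw [hRb] at this
  simpa using this

end

theorem whitehead_aux {F : Type*} [Field F] [CharZero F] {g : Type*} [LieRing g] [LieAlgebra F g] [FiniteDimensional F g]
  [HasTrivialRadical F g] (n : ℕ) : ∀ (E : Type*) [AddCommGroup E] [Module F E] [LieRingModule g E]
  [LieModule F g E] [FiniteDimensional F E] (φ : E →ₗ[F] F), Module.finrank F E = n →
  (∀ (x : g) (e : E), φ ⁅x, e⁆ = 0) → φ ≠ 0 → ∃ e, φ e ≠ 0 ∧ ∀ x : g, ⁅x, e⁆ = 0 := by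
  induction n using Nat.strong_induction_on with
  | _ n ih =>
  intro E _ _ _ _ _ φ hn hφ h0
  obtain ⟨e, he⟩ : ∃ e, φ e ≠ 0 := by
    by_contra! h
    exact h0 (LinearMap.ext h)
  let N : LieIdeal F g := (toEnd F g E).ker
  have hNm : ∀ x, x ∈ N ↔ ∀ e : E, ⁅x, e⁆ = 0 := by
    intro x
    simp [N, LieHom.mem_ker, LinearMap.ext_iff]
  let C := N.killingCompl
  have hNC : IsCompl N C := LieIdeal.isCompl_killingCompl N
  have hdec : ∀ x : g, ∃ y ∈ C, ∀ e : E, ⁅x, e⁆ = ⁅y, e⁆ := by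
    intro x
    have : x ∈ N ⊔ C := by rw [hNC.sup_eq_top]; trivial
    obtain ⟨y, hy, z, hz, rfl⟩ := (LieSubmodule.mem_sup _ _ _).1 this
    exact ⟨z, hz, fun e => by rw [add_lie, (hNm y).1 hy, zero_add]⟩
  have hB : (traceForm F C E).Nondegenerate := by
    refine traceForm_nondeg F E C (fun x hx hxe => ?_) hdec
    have : x ∈ N ⊓ C := ⟨(hNm x).2 hxe, hx⟩
    rw [hNC.inf_eq_bot] at this
    simpa using this
  obtain ⟨c, hc, htr, hcφ⟩ := casimir_exists F E hB
  have hcg : ∀ (x : g) (e : E), c ⁅x, e⁆ = ⁅x, c e⁆ := by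
    intro x e
    obtain ⟨y, hy, hxy⟩ := hdec x
    rw [hxy, hxy]
    exact hc ⟨y, hy⟩ e
  have hcφ' : ∀ e, φ (c e) = 0 := hcφ φ (fun x e => hφ x e)
  by_cases hnil : IsNilpotent c
  · have h1 : LinearMap.trace F E c = 0 := (LinearMap.isNilpotent_trace_of_isNilpotent hnil).eq_zero
    rw [h1] at htr
    have h2 : Module.finrank F C = 0 := by exact_mod_cast htr.symm
    refine ⟨e, he, fun x => ?_⟩
    obtain ⟨y, hy, hxy⟩ := hdec x
    have : Subsingleton C := Module.finrank_zero_iff.1 h2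
    have : (⟨y, hy⟩ : C) = 0 := Subsingleton.elim _ _
    have : y = 0 := congrArg Subtype.val this
    rw [hxy, this, zero_lie]
  · obtain ⟨m, hm⟩ := Filter.eventually_atTop.1 c.eventually_isCompl_ker_pow_range_pow
    replace hm := hm (m+1) (by omega)
    have hcp : ∀ (k : ℕ) (x : g) (e : E), (c ^ k) ⁅x, e⁆ = ⁅x, (c ^ k) e⁆ := by
      intro k
      induction k with
      | zero => intro x e; simp
      | succ k ih => intro x e; rw [pow_succ, Module.End.mul_apply, Module.End.mul_apply, hcg, ih]
    let E0 : LieSubmodule F g E :=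
      { LinearMap.ker (c ^ (m+1)) with
        lie_mem := by
          intro x e h
          have h : (c ^ (m+1)) e = 0 := h
          change (c ^ (m+1)) ⁅x, e⁆ = 0
          rw [hcp, h, lie_zero] }
    have hlt : Module.finrank F E0 < n := by
      rw [← hn]
      refine Submodule.finrank_lt (s := LinearMap.ker (c ^ (m+1))) ?_
      intro htop
      exact hnil ⟨m+1, LinearMap.ker_eq_top.1 htop⟩
    have : e ∈ LinearMap.ker (c ^ (m+1)) ⊔ LinearMap.range (c ^ (m+1)) := by
      rw [hm.sup_eq_top]; trivial
    obtain ⟨e0, h0', e1, ⟨e2, rfl⟩, rfl⟩ := Submodule.mem_sup.1 this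
    have hφ1 : φ ((c ^ (m+1)) e2) = 0 := by
      rw [pow_succ', Module.End.mul_apply, hcφ']
    obtain ⟨f, hf, hf'⟩ := ih _ hlt E0 (φ ∘ₗ (E0 : Submodule F E).subtype) rfl
      (fun x e => hφ x e) (fun h => he (by
        rw [map_add, hφ1, add_zero]
        exact LinearMap.congr_fun h ⟨e0, h0'⟩))
    exact ⟨f, hf, fun x => congrArg Subtype.val (hf' x)⟩

/-- The left multiplications form a Lie subalgebra. -/
def leftMulLie (F : Type*) [Field F] {L : Type*} [AddCommGroup L] [Module F L]
    (l : L →ₗ[F] Module.End F L) (hl : ∀ x y, l (l x y) = l x * l y - l y * l x) :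
    LieSubalgebra F (Module.End F L) :=
  { LinearMap.range l with
    lie_mem' := by
      rintro _ _ ⟨x, rfl⟩ ⟨y, rfl⟩
      exact ⟨l x y, by rw [hl]; rfl⟩ }

/-- Every finite-dimensional semi-simple non-Lie Leibniz algebra over a
field of characteristic zero has a derivation that is not inner (i.e., not a left
multiplication operator). -/
theorem semisimple_nonLie_exists_outer_derivation (F : Type v) [Field F] [CharZero F]
    (L : Type u) [AddCommGroup L] [Module F L] [FiniteDimensional F L]
    (mul : L → L → L) (hbil : IsBilinearMul F mul) (hleib : IsLeftLeibnizMul mul)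
    (hss : IsSemisimpleLeibniz F mul) (hnonlie : ∃ x : L, mul x x ≠ 0) :
    ∃ D : L →ₗ[F] L, (∀ x y : L, D (mul x y) = mul (D x) y + mul x (D y)) ∧
      ¬ ∃ x : L, ∀ y : L, D y = mul x y := by
  obtain ⟨ha, hb, hs, hs'⟩ := hbil
  let l : L →ₗ[F] Module.End F L := LinearMap.mk₂ F mul ha hs hb hs'
  have hlm : ∀ x y, l x y = mul x y := fun _ _ => rfl
  have hL : ∀ x y z, l x (l y z) = l (l x y) z + l y (l x z) := hleib
  have hl : ∀ x y, l (l x y) = l x * l y - l y * l x := by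
    intro x y
    ext z
    simp [hL x y z]
  set K := leibKer F mul with hKdef
  have hsq : ∀ x, l x x ∈ K := fun x => Submodule.subset_span ⟨x, rfl⟩
  have hK0 : ∀ k ∈ K, l k = 0 := by
    intro k hk
    have : K ≤ LinearMap.ker l := by
      refine Submodule.span_le.2 ?_
      rintro _ ⟨x, rfl⟩
      change l (l x x) = 0
      rw [hl, sub_self]
    exact this hk
  have hKl : ∀ x, ∀ k ∈ K, l x k ∈ K := by
    intro x k hk
    have : K ≤ K.comap (l x) := by
      refine Submodule.span_le.2 ?_
      rintro _ ⟨y, rfl⟩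
      change l x (l y y) ∈ K
      have : l x (l y y) = l (l x y + y) (l x y + y) - l (l x y) (l x y) - l y y := by
        rw [hL]; simp only [map_add, LinearMap.add_apply]; abel
      rw [this]
      exact K.sub_mem (K.sub_mem (hsq _) (hsq _)) (hsq _)
    exact this hk
  -- an ideal whose products are left-central is contained in `K`
  have hsolv : ∀ J : Submodule F L, IsIdealOf F mul J → (∀ a ∈ J, ∀ b ∈ J, l (l a b) = 0) → J ≤ K := by
    intro J hJ h
    refine hss J hJ ⟨2, ?_⟩
    have h1 : derSeries F mul J 1 ≤ LinearMap.ker l := by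
      refine Submodule.span_le.2 ?_
      rintro _ ⟨a, haJ, b, hbJ, rfl⟩
      exact h a haJ b hbJ
    refine le_bot_iff.1 (Submodule.span_le.2 ?_)
    rintro _ ⟨a, haJ, b, hbJ, rfl⟩
    have : l a = 0 := h1 haJ
    change l a b = 0
    rw [this]; rfl
  let G := leftMulLie F l hl
  have hGm : ∀ f, f ∈ G ↔ ∃ x, l x = f := fun f => Iff.rfl
  have hG : HasTrivialRadical F G := by
    rw [hasTrivialRadical_iff_no_abelian_ideals]
    intro I hI
    let lG : L →ₗ[F] G := l.codRestrict G.toSubmodule (fun x => ⟨x, rfl⟩)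
    have hlG : ∀ x y, lG (l x y) = ⁅lG x, lG y⁆ := by
      intro x y
      apply Subtype.ext
      exact hl x y
    let J : Submodule F L := I.toSubmodule.comap lG
    have hJ : J ≤ K := by
      refine hsolv J ?_ ?_
      · intro x a haJ
        have haJ : lG a ∈ I := haJ
        constructor
        · change lG (l x a) ∈ I
          rw [hlG]; exact I.lie_mem haJ
        · change lG (l a x) ∈ I
          rw [hlG]; exact lie_mem_left F G I _ _ haJ
      · intro a haJ b hbJ
        have h := hI.trivial ⟨lG a, haJ⟩ ⟨lG b, hbJ⟩
        have h' : ⁅lG a, lG b⁆ = 0 := congrArg Subtype.val h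
        rw [← hlG] at h'
        exact congrArg Subtype.val h'
    rw [eq_bot_iff]
    rintro ⟨f, x, rfl⟩ hf
    have := hK0 x (hJ hf)
    rw [LieSubmodule.mem_bot]
    exact Subtype.ext this
  -- the module
  obtain ⟨x0, hx0⟩ := hnonlie
  set k0 := l x0 x0 with hk0
  have hk0K : k0 ∈ K := hsq x0
  have hk00 : k0 ≠ 0 := hx0
  obtain ⟨ξ, hξ⟩ : ∃ ξ : Module.Dual F L, ξ k0 ≠ 0 := by
    by_contra! h
    exact hk00 ((Module.forall_dual_apply_eq_zero_iff F k0).1 h)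
  have hbr : ∀ (x : G) (f : L →ₗ[F] L) (y : L), ⁅x, f⁆ y = x.1 (f y) - f (x.1 y) := by
    intro x f y
    rfl
  let E : LieSubmodule F G (L →ₗ[F] L) :=
    { carrier := {f | (∀ y, f y ∈ K) ∧ ∃ c : F, ∀ k ∈ K, f k = c • k}
      add_mem' := by
        rintro f g ⟨hf, c, hc⟩ ⟨hg, d, hd⟩
        exact ⟨fun y => K.add_mem (hf y) (hg y), c + d, fun k hk => by
          rw [LinearMap.add_apply, hc k hk, hd k hk, add_smul]⟩
      zero_mem' := ⟨fun y => K.zero_mem, 0, fun k hk => by simp⟩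
      smul_mem' := by
        rintro a f ⟨hf, c, hc⟩
        exact ⟨fun y => K.smul_mem a (hf y), a * c, fun k hk => by
          rw [LinearMap.smul_apply, hc k hk, mul_smul]⟩
      lie_mem := by
        rintro ⟨_, x, rfl⟩ f ⟨hf, c, hc⟩
        refine ⟨fun y => ?_, 0, fun k hk => ?_⟩
        · rw [hbr]; exact K.sub_mem (hKl _ _ (hf _)) (hf _)
        · rw [hbr]
          change l x (f k) - f (l x k) = _
          rw [hc k hk, hc _ (hKl x k hk), map_smul, sub_self, zero_smul] }
  have hEm : ∀ f, f ∈ E ↔ (∀ y, f y ∈ K) ∧ ∃ c : F, ∀ k ∈ K, f k = c • k := fun f => Iff.rfl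
  let φ : E →ₗ[F] F := (ξ ∘ₗ LinearMap.applyₗ k0) ∘ₗ (E : Submodule F (L →ₗ[F] L)).subtype
  have hφ : ∀ f : E, φ f = ξ (f.1 k0) := fun _ => rfl
  have hφ1 : ∀ (x : G) (f : E), φ ⁅x, f⁆ = 0 := by
    rintro ⟨_, x, rfl⟩ ⟨f, hf, c, hc⟩
    rw [hφ]
    change ξ (l x (f k0) - f (l x k0)) = 0
    rw [hc _ hk0K, hc _ (hKl x _ hk0K), map_smul, sub_self, map_zero]
  have hφ0 : φ ≠ 0 := by
    obtain ⟨p, hp⟩ := K.subtype.exists_leftInverse_of_injective (Submodule.ker_subtype K)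
    have hp' : ∀ k (hk : k ∈ K), p k = ⟨k, hk⟩ := fun k hk => LinearMap.congr_fun hp ⟨k, hk⟩
    intro h
    have := LinearMap.congr_fun h ⟨K.subtype ∘ₗ p, fun y => (p y).2, 1, fun k hk => by
      rw [one_smul, LinearMap.comp_apply, hp' k hk]; rfl⟩
    rw [hφ] at this
    apply hξ
    change ξ ((p k0 : K) : L) = 0 at this
    rwa [hp' k0 hk0K] at this
  obtain ⟨⟨f, hf⟩, hfφ, hfinv⟩ := whitehead_aux (g := G) _ E φ rfl hφ1 hφ0
  have hfK := hf.1
  have hfx : ∀ x y, f (l x y) = l x (f y) := by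
    intro x y
    have h : ⁅(⟨l x, x, rfl⟩ : G), f⁆ = 0 := congrArg Subtype.val (hfinv ⟨l x, x, rfl⟩)
    have h' := LinearMap.congr_fun h y
    rw [hbr] at h'
    exact (sub_eq_zero.1 h').symm
  refine ⟨f, fun x y => ?_, ?_⟩
  · change f (l x y) = l (f x) y + l x (f y)
    rw [hfx, hK0 _ (hfK x)]; simp
  · rintro ⟨x, hx⟩
    let J : Submodule F L :=
      { carrier := {a | ∀ y, l a y ∈ K}
        add_mem' := by
          intro a b h1 h2 y
          rw [map_add]; exact K.add_mem (h1 y) (h2 y)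
        zero_mem' := by intro y; rw [map_zero]; exact K.zero_mem
        smul_mem' := by
          intro c a h y
          rw [map_smul]; exact K.smul_mem c (h y) }
    have hJ : J ≤ K := by
      refine hsolv J ?_ ?_
      · intro z a haJ
        constructor
        · intro y
          change l (l z a) y ∈ K
          rw [hl]
          exact K.sub_mem (hKl _ _ (haJ _)) (haJ _)
        · intro y
          change l (l a z) y ∈ K
          rw [hK0 _ (haJ z)]; exact K.zero_mem
      · intro a haJ b _
        exact hK0 _ (haJ b)
    have hxJ : x ∈ J := by
      intro y
      rw [hlm, ← hx]; exact hfK y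
    have := hK0 x (hJ hxJ)
    apply hfφ
    rw [hφ]
    change ξ (f k0) = 0
    rw [hx, ← hlm, this]; simp
end

section
/- Let F be a field of characteristic zero and let L be a finite-dimensional semi-simple left Leibniz algebra over F. Then the rank of L is never equal to one: dim_F Leib(L) ≠ 1. -/
universe u v w

/-- Characters of a Killing Lie algebra vanish. -/
lemma aux_char {F : Type v} [Field F] {g : Type u} [LieRing g] [LieAlgebra F g]
    [FiniteDimensional F g] [LieAlgebra.IsKilling F g] (l : g →ₗ[F] F)
    (hl : ∀ x y : g, l ⁅x, y⁆ = 0) : l = 0 := by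
  have nd := LieAlgebra.IsKilling.killingForm_nondegenerate F g
  obtain ⟨u, hu⟩ := (LinearMap.BilinForm.toDual (killingForm F g) nd).surjective l
  have hu' : ∀ x, killingForm F g u x = l x := fun x => by
    rw [← hu, LinearMap.BilinForm.toDual_def]
  have h1 : ∀ x : g, ⁅u, x⁆ = 0 := fun x => by
    apply nd.1
    intro y
    rw [LieModule.traceForm_apply_lie_apply, hu', hl]
  have h2 : u ∈ LieAlgebra.center F g := by
    rw [LieModule.mem_maxTrivSubmodule]
    intro x
    rw [← lie_skew, h1, neg_zero]
  rw [LieAlgebra.center_eq_bot, LieSubmodule.mem_bot] at h2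
  rw [← hu, h2, map_zero]

lemma aux_cocycle {F : Type v} [Field F] {g : Type u} [LieRing g] [LieAlgebra F g]
    [FiniteDimensional F g] [LieAlgebra.IsKilling F g] (f : g →ₗ[F] g →ₗ[F] F)
    (hf : ∀ x y z : g, f x ⁅y, z⁆ = f ⁅x, y⁆ z + f y ⁅x, z⁆) (x : g) : f x x = 0 := by
  have nd := LieAlgebra.IsKilling.killingForm_nondegenerate F g
  let e := LinearMap.BilinForm.toDual (killingForm F g) nd
  let D : g →ₗ[F] g := e.symm.toLinearMap ∘ₗ f
  have hD : ∀ x y, killingForm F g (D x) y = f x y := fun x y => by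
    rw [← LinearMap.BilinForm.toDual_def (b := nd)]
    change e (e.symm (f x)) y = f x y
    rw [e.apply_symm_apply]
  let D' : LieDerivation F g g := ⟨D, fun a b => by
    have h0 : D ⁅a, b⁆ - (⁅D a, b⁆ - ⁅D b, a⁆) = 0 := by
      apply nd.1
      intro z
      rw [map_sub, map_sub, LinearMap.sub_apply, LinearMap.sub_apply,
        LieModule.traceForm_apply_lie_apply, LieModule.traceForm_apply_lie_apply, hD, hD, hD, hf]
      ring
    rw [sub_eq_zero.mp h0, ← lie_skew b, ← lie_skew a]
    abel⟩
  obtain ⟨w, hw⟩ := LieDerivation.IsKilling.exists_eq_ad D'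
  have h : D x = ⁅w, x⁆ := by
    change D' x = _
    rw [← hw]; simp
  rw [← hD, h, LieModule.traceForm_apply_lie_apply, lie_self, map_zero]

lemma aux_core {F : Type v} [Field F] [CharZero F]
    {L : Type u} [AddCommGroup L] [Module F L]
    (m : L →ₗ[F] L →ₗ[F] L) (hleib : IsLeftLeibnizMul (fun x y => m x y))
    (hss : IsSemisimpleLeibniz F (fun x y => m x y))
    (hl0 : ∀ k ∈ leibKer F (fun x y => m x y), ∀ x, m k x = 0)
    {g : Type u} [LieRing g] [LieAlgebra F g] [FiniteDimensional F g]
    (π : L →ₗ[F] g) (hπ : Function.Surjective π) (hker : LinearMap.ker π = leibKer F (fun x y => m x y))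
    (hmul : ∀ x y, π (m x y) = ⁅π x, π y⁆) :
    Module.finrank F (leibKer F (fun x y => m x y)) ≠ 1 := by
  set K := leibKer F (fun x y => m x y) with hK
  have hrad : LieAlgebra.HasTrivialRadical F g := by
    rw [LieAlgebra.hasTrivialRadical_iff_no_abelian_ideals]
    intro I hI
    have hle : (I.toSubmodule.comap π) ≤ K := by
      apply hss
      · intro x a ha
        simp only [Submodule.mem_comap, hmul] at ha ⊢
        exact ⟨lie_mem_right F g I _ _ ha, lie_mem_left F g I _ _ ha⟩
      · refine ⟨2, ?_⟩
        have h1 : derSeries F (fun x y => m x y) (I.toSubmodule.comap π) 1 ≤ K := by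
          simp only [derSeries]
          rw [Submodule.span_le]
          rintro z ⟨a, ha, b, hb, rfl⟩
          change _ ∈ K
          rw [← hker, LinearMap.mem_ker, hmul]
          have := hI.trivial ⟨π a, ha⟩ ⟨π b, hb⟩
          simpa using congrArg Subtype.val this
        rw [derSeries, Submodule.span_eq_bot]
        rintro z ⟨a, ha, b, hb, rfl⟩
        exact hl0 a (h1 ha) b
    rw [eq_bot_iff]
    intro y hy
    obtain ⟨x, rfl⟩ := hπ y
    have : x ∈ LinearMap.ker π := hker ▸ hle hy
    rw [LieSubmodule.mem_bot]; exact this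
  intro h1
  obtain ⟨e, he0, he⟩ := finrank_eq_one_iff'.mp h1
  have heK : (e : L) ∈ K := e.2
  obtain ⟨s, hs⟩ := π.exists_rightInverse_of_surjective (LinearMap.range_eq_top.mpr hπ)
  have hs' : ∀ x, s (π x) - x ∈ K := fun x => by
    rw [← hker, LinearMap.mem_ker, map_sub, sub_eq_zero]
    exact LinearMap.congr_fun hs (π x)
  have hme : ∀ x, ∃ c : F, m x e = c • (e : L) := fun x => by
    have hx : m x e ∈ K := by
      have hee : π e = 0 := by
        have h : ∀ k ∈ K, π k = 0 := fun k hk => by rwa [← hker, LinearMap.mem_ker] at hk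
        exact h _ heK
      have h : ∀ k, π k = 0 → k ∈ K := fun k hk => by rwa [← hker, LinearMap.mem_ker]
      apply h
      rw [hmul, hee, lie_zero]
    obtain ⟨c, hc⟩ := he ⟨_, hx⟩
    exact ⟨c, (congrArg Subtype.val hc).symm⟩
  have hbr : ∀ x y, m (m x y) e = 0 := fun x y => by
    obtain ⟨c, hc⟩ := hme x
    obtain ⟨d, hd⟩ := hme y
    have h := hleib x y e
    simp only [hc, hd, map_smul, smul_smul] at h
    rw [mul_comm] at h
    simpa using h
  have hsl : ∀ x z, m (s (π x)) z = m x z := fun x z => by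
    rw [← sub_eq_zero, ← LinearMap.sub_apply, ← map_sub]
    exact hl0 _ (hs' x) z
  have hxe : ∀ x, m x e = 0 := fun x => by
    rw [← Module.forall_dual_apply_eq_zero_iff F]
    intro P
    have h := aux_char (P ∘ₗ (m.flip e) ∘ₗ s) (fun y z => by
      obtain ⟨y, rfl⟩ := hπ y
      obtain ⟨z, rfl⟩ := hπ z
      simp only [LinearMap.comp_apply, LinearMap.flip_apply]
      rw [← hmul, hsl, hbr, map_zero])
    have h' := LinearMap.congr_fun h (π x)
    simp only [LinearMap.comp_apply, LinearMap.flip_apply] at h'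
    rw [hsl] at h'
    exact h'
  have hr0 : ∀ k ∈ K, ∀ x, m x k = 0 := fun k hk x => by
    obtain ⟨c, hc⟩ := he ⟨k, hk⟩
    have : k = c • (e : L) := (congrArg Subtype.val hc).symm
    rw [this, map_smul, hxe, smul_zero]
  have hsr : ∀ x z, m x (s (π z)) = m x z := fun x z => by
    rw [← sub_eq_zero, ← map_sub]
    exact hr0 _ (hs' z) x
  have hsq : ∀ x, m x x = 0 := fun x => by
    rw [← Module.forall_dual_apply_eq_zero_iff F]
    intro P
    have h := aux_cocycle ((m.compl₁₂ s s).compr₂ P) (fun x y z => by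
      obtain ⟨x, rfl⟩ := hπ x
      obtain ⟨y, rfl⟩ := hπ y
      obtain ⟨z, rfl⟩ := hπ z
      simp only [LinearMap.compr₂_apply, LinearMap.compl₁₂_apply, ← hmul, hsl, hsr]
      rw [← map_add]
      exact congrArg P (hleib x y z)) (π x)
    simpa only [LinearMap.compr₂_apply, LinearMap.compl₁₂_apply, hsl, hsr] using h
  have hK0 : K = ⊥ := by
    rw [hK, leibKer, Submodule.span_eq_bot]
    rintro z ⟨x, rfl⟩
    exact hsq x
  rw [hK0, finrank_bot] at h1
  exact zero_ne_one h1

/-- The rank (the dimension of the Leibniz kernel) of a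
finite-dimensional semi-simple left Leibniz algebra over a field of characteristic
zero is never equal to one. -/
theorem semisimple_rank_ne_one (F : Type v) [Field F] [CharZero F]
    (L : Type u) [AddCommGroup L] [Module F L] [FiniteDimensional F L]
    (mul : L → L → L) (hbil : IsBilinearMul F mul) (hleib : IsLeftLeibnizMul mul)
    (hss : IsSemisimpleLeibniz F mul) :
    Module.finrank F (leibKer F mul) ≠ 1 := by
  obtain ⟨hadd, hadd', hsm, hsm'⟩ := hbil
  let m : L →ₗ[F] L →ₗ[F] L := LinearMap.mk₂ F mul hadd hsm hadd' hsm'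
  have hm : (fun x y => m x y) = mul := rfl
  have hm' : ∀ x y, mul x y = m x y := fun _ _ => rfl
  let K := leibKer F mul
  have hsqK : ∀ x, m x x ∈ K := fun x => Submodule.subset_span ⟨x, rfl⟩
  have hsymK : ∀ x y, m x y + m y x ∈ K := fun x y => by
    have h := K.sub_mem (K.sub_mem (hsqK (x + y)) (hsqK x)) (hsqK y)
    convert h using 1
    simp only [map_add, LinearMap.add_apply]
    abel
  have hl0 : ∀ k ∈ K, ∀ x, m k x = 0 := by
    intro k hk x
    have : K ≤ LinearMap.ker (m.flip x) := by
      refine Submodule.span_le.mpr ?_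
      rintro z ⟨y, rfl⟩
      simpa [hm'] using hleib y y x
    exact this hk
  have hrK : ∀ x, K ≤ K.comap (m x) := by
    intro x
    refine Submodule.span_le.mpr ?_
    rintro z ⟨y, rfl⟩
    change m x (mul y y) ∈ K
    have h := hleib x y y
    rw [← hm' x, h]
    exact hsymK _ _
  let r : L →ₗ[F] (L ⧸ K) →ₗ[F] (L ⧸ K) :=
    { toFun := fun x => K.mapQ K (m x) (hrK x)
      map_add' := fun x y => by ext z; simp
      map_smul' := fun c x => by ext z; simp }
  let q : (L ⧸ K) →ₗ[F] (L ⧸ K) →ₗ[F] (L ⧸ K) := K.liftQ r (fun k hk => by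
    rw [LinearMap.mem_ker]
    ext z
    simp [r, hl0 k hk])
  have hq : ∀ x y : L, q (K.mkQ x) (K.mkQ y) = K.mkQ (m x y) := fun x y => rfl
  have hsurj : Function.Surjective K.mkQ := K.mkQ_surjective
  let ringInst : LieRing (L ⧸ K) :=
    { bracket := fun x y => q x y
      add_lie := fun x y z => by change q (x + y) z = q x z + q y z; simp
      lie_add := fun x y z => by change q x (y + z) = q x y + q x z; simp
      lie_self := fun x => by
        obtain ⟨x, rfl⟩ := hsurj x
        change q _ _ = 0
        rw [hq, ← LinearMap.mem_ker, Submodule.ker_mkQ]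
        exact hsqK x
      leibniz_lie := fun x y z => by
        obtain ⟨x, rfl⟩ := hsurj x
        obtain ⟨y, rfl⟩ := hsurj y
        obtain ⟨z, rfl⟩ := hsurj z
        change q _ (q _ _) = q (q _ _) _ + q _ (q _ _)
        simp only [hq]
        rw [← map_add]
        exact congrArg K.mkQ (hleib x y z) }
  let algInst : LieAlgebra F (L ⧸ K) :=
    { lie_smul := fun c x y => by change q x (c • y) = c • q x y; simp }
  exact aux_core m hleib hss hl0 K.mkQ hsurj K.ker_mkQ (fun x y => rfl)
end
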